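/- Let 𝒜 be an abelian category, 𝒳 extension-closed, and 𝒲 an 𝒳-projective generator for 𝒳. Then the class 𝒳̌ of objects admitting a finite coresolution by objects of 𝒳 is closed under extensions: if 0 → A → B → C → 0 is exact with A, C ∈ 𝒳̌, then B ∈ 𝒳̌. -/

import Mathlib

open CategoryTheory CategoryTheory.Limits Opposite

universe v u

variable {A : Type u} [Category.{v} A] [Abelian A]

/-- `IsSES f g` : `0 → X → Y → Z → 0` is a short exact sequence. -/
def IsSES {X Y Z : A} (f : X ⟶ Y) (g : Y ⟶ Z) : Prop :=
  ∃ w : f ≫ g = 0, (ShortComplex.mk f g w).ShortExact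

/-- `HasCoresLE S n C` : `C` admits a coresolution `0 → C → X₀ → ⋯ → X₋ₙ → 0`
with all terms in `S`. -/
def HasCoresLE (S : Set A) : ℕ → A → Prop
  | 0, C => C ∈ S
  | n+1, C => ∃ (X K : A) (f : C ⟶ X) (g : X ⟶ K), X ∈ S ∧ IsSES f g ∧ HasCoresLE S n K

/-- `S` is closed under extensions. -/
def ExtClosed (S : Set A) : Prop :=
  ∀ ⦃X Y Z : A⦄ (f : X ⟶ Y) (g : Y ⟶ Z), IsSES f g → X ∈ S → Z ∈ S → Y ∈ S

/-- `S` is closed under cokernels of monomorphisms. -/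
def CokerClosed (S : Set A) : Prop :=
  ∀ ⦃X Y Z : A⦄ (f : X ⟶ Y) (g : Y ⟶ Z), IsSES f g → X ∈ S → Y ∈ S → Z ∈ S

/-- `S` is closed under kernels of epimorphisms. -/
def KerClosed (S : Set A) : Prop :=
  ∀ ⦃X Y Z : A⦄ (f : X ⟶ Y) (g : Y ⟶ Z), IsSES f g → Y ∈ S → Z ∈ S → X ∈ S

/-- `W` is a generator for `X` : every object of `X` receives an epimorphism from
an object of `W` with kernel in `X`. -/
def IsGen (W X : Set A) : Prop :=
  W ⊆ X ∧ ∀ C ∈ X, ∃ (X' W₀ : A) (f : X' ⟶ W₀) (g : W₀ ⟶ C),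
    W₀ ∈ W ∧ X' ∈ X ∧ IsSES f g

/-- `Extⁱ(X, Y) = 0`. -/
def ExtVanish [EnoughProjectives A] (i : ℕ) (X Y : A) : Prop :=
  IsZero (((Ext ℤ A i).obj (op X)).obj Y)

/-- `W` is `X`-projective: `Extⁱ(W, X) = 0` for all `i ≥ 1`. -/
def IsXProj [EnoughProjectives A] (W X : Set A) : Prop :=
  ∀ W' ∈ W, ∀ X' ∈ X, ∀ i : ℕ, 1 ≤ i → ExtVanish i W' X'

open CategoryTheory.Abelian in
/-- The derived-functor `Ext` used in the statement controls Mathlib's `Abelian.Ext`. -/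
theorem ext_eq_zero_of_extVanish [EnoughProjectives A] [HasExt.{v} A] (X Y : A) (n : ℕ)
    (h : ExtVanish (n + 1) X Y) (α : Abelian.Ext.{v} X Y (n + 1)) : α = 0 := by
  let R : ProjectiveResolution X := ProjectiveResolution.of X
  obtain ⟨f, hf, rfl⟩ := R.extMk_surjective α (n + 2) rfl
  rw [R.extMk_eq_zero_iff f (n + 2) rfl hf n rfl]
  have h1 := IsZero.of_iso h (R.isoExt (R := ℤ) (n + 1) Y).symm
  rw [← HomologicalComplex.exactAt_iff_isZero_homology,
    HomologicalComplex.exactAt_iff' _ n (n + 1) (n + 2) (by simp) (by simp),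
    ShortComplex.moduleCat_exact_iff] at h1
  obtain ⟨g, hg⟩ := h1 f hf
  exact ⟨g, hg⟩

theorem isSES_mk {X Y Z : A} (f : X ⟶ Y) (g : Y ⟶ Z) [Mono f] [Epi g] (w : f ≫ g = 0)
    (h : ∀ {T : A} (t : T ⟶ Y), t ≫ g = 0 → ∃ s, s ≫ f = t) : IsSES f g := by
  refine ⟨w, ?_⟩
  have : (ShortComplex.mk f g w).Exact := by
    apply ShortComplex.exact_of_f_is_kernel
    exact KernelFork.IsLimit.ofι' _ _ (fun t ht => ⟨(h t ht).choose, (h t ht).choose_spec⟩)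
  exact { exact := this, mono_f := ‹_›, epi_g := ‹_› }

theorem IsSES.lift {X Y Z : A} {f : X ⟶ Y} {g : Y ⟶ Z} (h : IsSES f g) {T : A} (t : T ⟶ Y)
    (ht : t ≫ g = 0) : ∃ s, s ≫ f = t := by
  obtain ⟨w, h⟩ := h
  have := h.mono_f
  exact ⟨h.exact.lift t ht, h.exact.lift_f t ht⟩

theorem IsSES.mono {X Y Z : A} {f : X ⟶ Y} {g : Y ⟶ Z} (h : IsSES f g) : Mono f := h.2.mono_f

theorem IsSES.epi {X Y Z : A} {f : X ⟶ Y} {g : Y ⟶ Z} (h : IsSES f g) : Epi g := h.2.epi_g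

/-- Pulling back a short exact sequence. -/
theorem isSES_pullback {C X K L P : A} {f : C ⟶ X} {g : X ⟶ K} (h : IsSES f g) (k : L ⟶ K)
    {p : P ⟶ X} {q : P ⟶ L} (hP : IsPullback p q g k) :
    ∃ i : C ⟶ P, i ≫ p = f ∧ IsSES i q := by
  have := h.mono
  have := h.epi
  have w := h.1
  refine ⟨hP.lift f 0 (by simp [w]), by simp, ?_⟩
  have hf : Mono (hP.lift f 0 (by simp [w]) ≫ p) := by simpa
  have : Mono (hP.lift f 0 (by simp [w])) := mono_of_mono _ p
  have : Epi q := by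
    rw [← hP.isoPullback_hom_snd]
    infer_instance
  refine isSES_mk _ _ (by simp) ?_
  intro T t ht
  obtain ⟨s, hs⟩ := h.lift (t ≫ p) (by rw [Category.assoc, hP.w, reassoc_of% ht, zero_comp])
  exact ⟨s, hP.hom_ext (by simp [hs]) (by simp [ht])⟩

/-- The pullback of a kernel along an epimorphism. -/
theorem isSES_pullback' {K X Y W P : A} {f : K ⟶ X} {g : X ⟶ Y} (h : IsSES f g) (k : W ⟶ X)
    [Epi k] {p : P ⟶ W} {q : P ⟶ K} (hP : IsPullback p q k f) :
    IsSES p (k ≫ g) := by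
  have := h.mono
  have := h.epi
  have : Mono p := by
    rw [← hP.isoPullback_hom_fst]
    infer_instance
  refine isSES_mk _ _ (by rw [hP.w_assoc, h.1, comp_zero]) ?_
  intro T t ht
  obtain ⟨s, hs⟩ := h.lift (t ≫ k) (by simpa using ht)
  exact ⟨hP.lift t s hs.symm, by simp⟩

/-- A form of the nine lemma. -/
theorem nine {A₁ B₁ C₁ A₂ B₂ C₂ A₃ C₃ : A} {f₁ : A₁ ⟶ B₁} {g₁ : B₁ ⟶ C₁} {f₂ : A₂ ⟶ B₂}
    {g₂ : B₂ ⟶ C₂} {a : A₁ ⟶ A₂} {b : B₁ ⟶ B₂} {c : C₁ ⟶ C₂} {a' : A₂ ⟶ A₃} {c' : C₂ ⟶ C₃}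
    (h₁ : IsSES f₁ g₁) (h₂ : IsSES f₂ g₂) (ha : IsSES a a') (hc : IsSES c c')
    (w₁ : a ≫ f₂ = f₁ ≫ b) (w₂ : b ≫ g₂ = g₁ ≫ c) :
    ∃ (B₃ : A) (b' : B₂ ⟶ B₃) (f₃ : A₃ ⟶ B₃) (g₃ : B₃ ⟶ C₃), IsSES b b' ∧ IsSES f₃ g₃ := by
  obtain ⟨z₁, h₁⟩ := h₁
  obtain ⟨z₂, h₂⟩ := h₂
  obtain ⟨za, ha⟩ := ha
  obtain ⟨zc, hc⟩ := hc
  have := ha.mono_f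
  have := hc.mono_f
  have := ha.epi_g
  have := hc.epi_g
  dsimp at *
  let τ : ShortComplex.mk f₁ g₁ z₁ ⟶ ShortComplex.mk f₂ g₂ z₂ :=
    { τ₁ := a, τ₂ := b, τ₃ := c }
  let S : ShortComplex.SnakeInput A :=
    { L₀ := kernel τ
      L₁ := _
      L₂ := _
      L₃ := cokernel τ
      v₀₁ := kernel.ι τ
      v₁₂ := τ
      v₂₃ := cokernel.π τ
      w₀₂ := kernel.condition τ
      w₁₃ := cokernel.condition τ
      h₀ := kernelIsKernel τ
      h₃ := cokernelIsCokernel τ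
      L₁_exact := h₁.exact
      epi_L₁_g := h₁.epi_g
      L₂_exact := h₂.exact
      mono_L₂_f := h₂.mono_f }
  have hmono₁ : IsZero S.L₀.X₁ := by
    have e := S.w₀₂_τ₁
    have : Mono S.v₀₁.τ₁ := mono_of_isLimit_fork S.h₀τ₁
    have : Mono S.v₁₂.τ₁ := ‹Mono a›
    exact IsZero.of_mono_eq_zero S.v₀₁.τ₁ (zero_of_comp_mono _ e)
  have hmono₃ : IsZero S.L₀.X₃ := by
    have e := S.w₀₂_τ₃
    have : Mono S.v₀₁.τ₃ := mono_of_isLimit_fork S.h₀τ₃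
    have : Mono S.v₁₂.τ₃ := ‹Mono c›
    exact IsZero.of_mono_eq_zero S.v₀₁.τ₃ (zero_of_comp_mono _ e)
  have hmono₂ : IsZero S.L₀.X₂ :=
    S.L₀_exact.isZero_of_both_zeros (hmono₁.eq_of_src _ _) (hmono₃.eq_of_tgt _ _)
  have hb : Mono b :=
    S.exact_C₂_up.mono_g (hmono₂.eq_of_src _ _)
  have hL₃f : Mono S.L₃.f := S.L₂'_exact.mono_g (hmono₃.eq_of_src _ _)
  have : Epi g₂ := h₂.epi_g
  have hepi : Epi S.v₂₃.τ₃ := epi_of_isColimit_cofork S.h₃τ₃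
  have hepi₂ : Epi S.v₂₃.τ₂ := epi_of_isColimit_cofork S.h₃τ₂
  have hL₃g : Epi S.L₃.g := by
    have : Epi (S.v₂₃.τ₂ ≫ S.L₃.g) := by
      rw [S.v₂₃.comm₂₃]
      have : Epi S.L₂.g := ‹Epi g₂›
      infer_instance
    exact epi_of_epi S.v₂₃.τ₂ S.L₃.g
  have hL₃ : S.L₃.ShortExact := { exact := S.L₃_exact, mono_f := hL₃f, epi_g := hL₃g }
  let e₁ : S.L₃.X₁ ≅ A₃ := S.h₃τ₁.coconePointUniqueUpToIso ha.gIsCokernel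
  let e₃ : S.L₃.X₃ ≅ C₃ := S.h₃τ₃.coconePointUniqueUpToIso hc.gIsCokernel
  have hz : (e₁.inv ≫ S.L₃.f) ≫ S.L₃.g ≫ e₃.hom = 0 := by simp
  refine ⟨S.L₃.X₂, S.v₂₃.τ₂, e₁.inv ≫ S.L₃.f, S.L₃.g ≫ e₃.hom, ⟨S.w₁₃_τ₂, ?_⟩, hz, ?_⟩
  · exact { exact := S.exact_C₂_down, mono_f := hb, epi_g := hepi₂ }
  · refine ShortComplex.shortExact_of_iso ?_ hL₃
    exact ShortComplex.isoMk e₁ (Iso.refl _) e₃ (by simp) (by simp)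

theorem HasCoresLE.mono {S T : Set A} (h : S ⊆ T) (n : ℕ) : ∀ {C : A},
    HasCoresLE S n C → HasCoresLE T n C := by
  induction n with
  | zero => intro C hC; exact h hC
  | succ n ih =>
    rintro C ⟨X, K, f, g, hX, hs, hK⟩
    exact ⟨X, K, f, g, h hX, hs, ih hK⟩

theorem isSES_biprod (X Y : A) : IsSES (biprod.inl : X ⟶ X ⊞ Y) (biprod.snd : X ⊞ Y ⟶ Y) := by
  refine isSES_mk _ _ (by simp) ?_
  intro T t ht
  exact ⟨t ≫ biprod.fst, by ext <;> simp [ht]⟩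

theorem HasCoresLE.succ {S : Set A} (h : ExtClosed S) (n : ℕ) : ∀ {C : A},
    HasCoresLE S n C → HasCoresLE S (n + 1) C := by
  induction n with
  | zero =>
    intro C hC
    exact ⟨_, _, _, _, h _ _ (isSES_biprod C C) hC hC, isSES_biprod C C, hC⟩
  | succ n ih =>
    rintro C ⟨X, K, f, g, hX, hs, hK⟩
    exact ⟨X, K, f, g, hX, hs, ih hK⟩

theorem HasCoresLE.le {S : Set A} (h : ExtClosed S) {m n : ℕ} (hmn : m ≤ n) {C : A}
    (hC : HasCoresLE S m C) : HasCoresLE S n C := by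
  induction hmn with
  | refl => exact hC
  | step _ ih => exact ih.succ h

/-- Auslander–Buchweitz type approximation. -/
theorem approx {𝒳 𝒲 : Set A} (hX : ExtClosed 𝒳) (hgen : IsGen 𝒲 𝒳) (n : ℕ) : ∀ {K : A},
    HasCoresLE 𝒳 n K → ∃ (X L : A) (f : X ⟶ L) (g : L ⟶ K), X ∈ 𝒳 ∧ HasCoresLE 𝒲 n L ∧
      IsSES f g := by
  induction n with
  | zero =>
    intro K hK
    obtain ⟨X, W, f, g, hW, hX', hs⟩ := hgen.2 K hK
    exact ⟨X, W, f, g, hX', hW, hs⟩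
  | succ n ih =>
    rintro K ⟨X₀, K₁, f, g, hX₀, hs, hK₁⟩
    obtain ⟨X', L, f', g', hX', hL, hs'⟩ := ih hK₁
    have hP := IsPullback.of_hasPullback g g'
    obtain ⟨i, -, hi⟩ := isSES_pullback hs g' hP
    obtain ⟨j, -, hj⟩ := isSES_pullback hs' g hP.flip
    obtain ⟨X'', W, f'', g'', hW, hX'', hs''⟩ := hgen.2 _ (hX _ _ hj hX' hX₀)
    have := hs''.epi
    have hQ := IsPullback.of_hasPullback g'' i
    obtain ⟨k, -, hk⟩ := isSES_pullback hs'' i hQ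
    exact ⟨X'', _, k, _, hX'', ⟨W, L, _, _, hW, isSES_pullback' hi g'' hQ, hL⟩, hk⟩

theorem approx' {𝒳 𝒲 : Set A} (hX : ExtClosed 𝒳) (hgen : IsGen 𝒲 𝒳) (n : ℕ) {C : A}
    (hC : HasCoresLE 𝒳 (n + 1) C) : ∃ (X L : A) (f : C ⟶ X) (g : X ⟶ L), X ∈ 𝒳 ∧
      HasCoresLE 𝒲 n L ∧ IsSES f g := by
  obtain ⟨X₀, K₁, f, g, hX₀, hs, hK₁⟩ := hC
  obtain ⟨X', L, f', g', hX', hL, hs'⟩ := approx hX hgen n hK₁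
  have hP := IsPullback.of_hasPullback g g'
  obtain ⟨i, -, hi⟩ := isSES_pullback hs g' hP
  obtain ⟨j, -, hj⟩ := isSES_pullback hs' g hP.flip
  exact ⟨_, L, i, _, hX _ _ hj hX' hX₀, hL, hi⟩

/-- Dimension shifting. -/
theorem ext_zero_cores [HasExt.{v} A] {𝒲 : Set A} {X : A}
    (h : ∀ W ∈ 𝒲, ∀ i, ∀ α : Abelian.Ext.{v} W X (i + 1), α = 0) (n : ℕ) :
    ∀ {Y : A}, HasCoresLE 𝒲 n Y → ∀ i, ∀ α : Abelian.Ext.{v} Y X (i + 1), α = 0 := by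
  induction n with
  | zero => intro Y hY; exact h Y hY
  | succ n ih =>
    rintro Y ⟨W, K, f, g, hW, ⟨w, hs⟩, hK⟩ i α
    obtain ⟨β, rfl⟩ := Abelian.Ext.contravariant_sequence_exact₁ hs X α (n₁ := i + 2) (by omega)
      (ih hK (i + 1) _)
    rw [h W hW i β, Abelian.Ext.comp_zero]

theorem horseshoe [EnoughInjectives A] [HasExt.{v} A] {A₁ B₁ C₁ A₂ C₂ C₃ : A}
    {f₁ : A₁ ⟶ B₁} {g₁ : B₁ ⟶ C₁} {a : A₁ ⟶ A₂} {c : C₁ ⟶ C₂} {c' : C₂ ⟶ C₃}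
    (h₁ : IsSES f₁ g₁) (hc : IsSES c c') (hv : ∀ α : Abelian.Ext.{v} C₃ A₂ 2, α = 0) :
    ∃ (B₂ : A) (b : B₁ ⟶ B₂) (f₂ : A₂ ⟶ B₂) (g₂ : B₂ ⟶ C₂), IsSES f₂ g₂ ∧
      a ≫ f₂ = f₁ ≫ b ∧ b ≫ g₂ = g₁ ≫ c := by
  have := h₁.mono
  have := h₁.epi
  let ι := Injective.ι A₂
  let π := cokernel.π ι
  have hI : IsSES ι π := ⟨cokernel.condition ι,
    { exact := ShortComplex.exact_cokernel ι
      mono_f := inferInstanceAs (Mono ι)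
      epi_g := inferInstanceAs (Epi (cokernel.π ι)) }⟩
  let u : B₁ ⟶ Injective.under A₂ := Injective.factorThru (a ≫ ι) f₁
  have hu : f₁ ≫ u = a ≫ ι := Injective.comp_factorThru _ _
  obtain ⟨z₁, hs₁⟩ := h₁
  obtain ⟨zI, hsI⟩ := hI
  obtain ⟨zc, hsc⟩ := hc
  obtain ⟨φ, hφ⟩ : ∃ φ : C₁ ⟶ cokernel ι, g₁ ≫ φ = u ≫ π := by
    have h0 : f₁ ≫ u ≫ π = 0 := by rw [reassoc_of% hu, zI, comp_zero]
    exact ⟨hs₁.exact.desc (u ≫ π) h0, hs₁.exact.g_desc _ h0⟩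
  have hQ : ∀ α : Abelian.Ext.{v} C₃ (cokernel ι) 1, α = 0 := by
    intro α
    obtain ⟨β, rfl⟩ := Abelian.Ext.covariant_sequence_exact₃ C₃ hsI α (n₁ := 2) rfl (hv _)
    have hβ : β = 0 := Abelian.Ext.eq_zero_of_injective (I := Injective.under A₂) β
    rw [hβ, Abelian.Ext.zero_comp]
  obtain ⟨ψ, hψ⟩ : ∃ ψ : C₂ ⟶ cokernel ι, c ≫ ψ = φ := by
    obtain ⟨x, hx⟩ := Abelian.Ext.contravariant_sequence_exact₁ hsc (cokernel ι)
      (Abelian.Ext.mk₀ φ) (n₁ := 1) rfl (hQ _)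
    obtain ⟨ψ, rfl⟩ := (Abelian.Ext.mk₀_bijective _ _).2 x
    refine ⟨ψ, (Abelian.Ext.mk₀_bijective _ _).1 ?_⟩
    rw [← hx, Abelian.Ext.mk₀_comp_mk₀]
  have hP := IsPullback.of_hasPullback π ψ
  obtain ⟨f₂, hf₂, hs₂⟩ := isSES_pullback ⟨zI, hsI⟩ ψ hP
  refine ⟨_, hP.lift u (g₁ ≫ c) (by rw [Category.assoc, hψ, hφ]), f₂, _, hs₂, ?_, by simp⟩
  apply hP.hom_ext
  · simp [hf₂, hu]
  · have := hs₂.1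
    simp [this, reassoc_of% z₁]

/-- Corollary 3.7, abelian version: the class of objects with a finite
`𝒳`-coresolution is closed under extensions. -/
theorem stmt4 [EnoughProjectives A] [EnoughInjectives A]
    (𝒳 𝒲 : Set A) (hX : ExtClosed 𝒳) (hgen : IsGen 𝒲 𝒳) (hproj : IsXProj 𝒲 𝒳) :
    ExtClosed {C : A | ∃ n, HasCoresLE 𝒳 n C} := by
  have : HasExt.{v} A := CategoryTheory.hasExt_of_enoughProjectives.{v} A
  have key : ∀ n, ExtClosed {C : A | HasCoresLE 𝒳 n C} := by
    intro n
    induction n with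
    | zero => exact hX
    | succ n ih =>
      rintro A₁ B₁ C₁ f₁ g₁ h₁ ⟨A₂, A₃, a, a', hA₂, ha, hA₃⟩ hC
      obtain ⟨C₂, C₃, c, c', hC₂, hC₃, hc⟩ := approx' hX hgen n hC
      obtain ⟨B₂, b, f₂, g₂, hs₂, w₁, w₂⟩ := horseshoe (a := a) h₁ hc
        (ext_zero_cores (fun W hW i => ext_eq_zero_of_extVanish W A₂ i
          (hproj W hW A₂ hA₂ (i + 1) (by omega))) n hC₃ 1)
      obtain ⟨B₃, b', f₃, g₃, hb, hs₃⟩ := nine h₁ hs₂ ha hc w₁ w₂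
      exact ⟨B₂, B₃, b, b', hX _ _ hs₂ hA₂ hC₂, hb, ih _ _ hs₃ hA₃ (hC₃.mono hgen.1)⟩
  rintro A₁ B₁ C₁ f₁ g₁ h₁ ⟨m, hm⟩ ⟨n, hn⟩
  exact ⟨max m n, key _ f₁ g₁ h₁ (hm.le hX (le_max_left _ _)) (hn.le hX (le_max_right _ _))⟩
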